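/- Maupertuis principle for collision arcs: let u ∈ H¹([0,T];ℝ²) be a minimizer of M_h over paths from q to 0 with M_h(u) > 0, and set ω = ( ∫₀ᵀ(h+V(u)) / ((1/2)∫₀ᵀ|u̇|²) )^{1/2}. Then u is a classical solution of ω² ü = ∇V(u) on (0,T), and x(t) = u(ωt) solves ẍ = ∇V(x) with (1/2)|ẋ|² − V(x) = h on [0, T/ω), with x(0)=q and x(t) → 0 as t → T/ω. -/

import Mathlib

open Set MeasureTheory intervalIntegral Filter

noncomputable def Vpot (α : ℝ) (U : EuclideanSpace ℝ (Fin 2) → ℝ)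
    (x : EuclideanSpace ℝ (Fin 2)) : ℝ :=
  ‖x‖ ^ (-α) * U (‖x‖⁻¹ • x)

/-- The Maupertuis functional on `[0,T]`. -/
noncomputable def MaupertuisT (α h T : ℝ) (U : EuclideanSpace ℝ (Fin 2) → ℝ)
    (u : ℝ → EuclideanSpace ℝ (Fin 2)) : ℝ :=
  ((1/2) * ∫ s in (0:ℝ)..T, ‖deriv u s‖ ^ 2) *
    (∫ s in (0:ℝ)..T, (h + Vpot α U (u s)))

/-- Membership in the class of (H¹) collision paths from `q` to `0` on `[0,T]`. -/
def AdmPath (α h T : ℝ) (U : EuclideanSpace ℝ (Fin 2) → ℝ)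
    (q : EuclideanSpace ℝ (Fin 2)) (u : ℝ → EuclideanSpace ℝ (Fin 2)) : Prop :=
  ContinuousOn u (Icc 0 T) ∧ (∀ s ∈ Ioo (0:ℝ) T, DifferentiableAt ℝ u s) ∧
    u 0 = q ∧ u T = 0 ∧
    IntervalIntegrable (fun s => ‖deriv u s‖ ^ 2) volume 0 T ∧
    IntervalIntegrable (fun s => h + Vpot α U (u s)) volume 0 T


section MaupAux

open scoped Topology ContDiff InnerProductSpace

abbrev E2 := EuclideanSpace ℝ (Fin 2)

section basics
variable {α : ℝ} {U : E2 → ℝ}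

lemma unit_norm {x : E2} (hx : x ≠ 0) : ‖‖x‖⁻¹ • x‖ = 1 := by
  rw [norm_smul, norm_inv, norm_norm, inv_mul_cancel₀ (norm_ne_zero_iff.2 hx)]

lemma Vpot_zero (hα : 0 < α) : Vpot α U 0 = 0 := by
  simp [Vpot, Real.zero_rpow (neg_ne_zero.2 hα.ne')]

lemma Vpot_pos (hUpos : ∀ s : E2, ‖s‖ = 1 → 0 < U s) {x : E2} (hx : x ≠ 0) :
    0 < Vpot α U x :=
  mul_pos (Real.rpow_pos_of_pos (norm_pos_iff.2 hx) _) (hUpos _ (unit_norm hx))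

lemma Vpot_nonneg (hα : 0 < α) (hUpos : ∀ s : E2, ‖s‖ = 1 → 0 < U s) (x : E2) :
    0 ≤ Vpot α U x := by
  rcases eq_or_ne x 0 with rfl | hx
  · rw [Vpot_zero hα]
  · exact (Vpot_pos hUpos hx).le

lemma Vpot_smul (x : E2) {c : ℝ} (hc : 0 < c) :
    Vpot α U (c • x) = c ^ (-α) * Vpot α U x := by
  unfold Vpot
  rw [norm_smul, Real.norm_of_nonneg hc.le, Real.mul_rpow hc.le (norm_nonneg _), smul_smul,
    mul_inv, mul_right_comm c⁻¹, inv_mul_cancel₀ hc.ne', one_mul, mul_assoc]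

lemma Vpot_contDiffAt (hUC2 : ContDiff ℝ 2 U) {x : E2} (hx : x ≠ 0) :
    ContDiffAt ℝ 2 (Vpot α U) x := by
  unfold Vpot
  have hn : ContDiffAt ℝ 2 (fun x : E2 => ‖x‖) x := contDiffAt_norm ℝ hx
  have h0 : ‖x‖ ≠ 0 := norm_ne_zero_iff.2 hx
  exact (hn.rpow_const_of_ne h0).mul
    (hUC2.contDiffAt.comp x ((hn.inv h0).smul contDiffAt_id))

lemma Vpot_diffAt (hUC2 : ContDiff ℝ 2 U) {x : E2} (hx : x ≠ 0) :
    DifferentiableAt ℝ (Vpot α U) x :=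
  (Vpot_contDiffAt hUC2 hx).differentiableAt (by norm_num)

lemma Vpot_fderiv_apply (x y : E2) :
    fderiv ℝ (Vpot α U) x y = ⟪gradient (Vpot α U) x, y⟫_ℝ := by
  rw [← toDual_gradient, InnerProductSpace.toDual_apply_apply]

lemma Vpot_contAt (hUC2 : ContDiff ℝ 2 U) {x : E2} (hx : x ≠ 0) :
    ContinuousAt (Vpot α U) x := (Vpot_contDiffAt hUC2 hx).continuousAt

lemma Vpot_gradient_contAt (hUC2 : ContDiff ℝ 2 U) {x : E2} (hx : x ≠ 0) :
    ContinuousAt (gradient (Vpot α U)) x := by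
  have h1 : ContinuousAt (fderiv ℝ (Vpot α U)) x :=
    ((Vpot_contDiffAt hUC2 hx).fderiv_right (m := 1) (by norm_num)).continuousAt
  exact (InnerProductSpace.toDual ℝ E2).symm.continuous.continuousAt.comp h1

lemma Vpot_euler (hUC2 : ContDiff ℝ 2 U) {x : E2} (hx : x ≠ 0) :
    ⟪gradient (Vpot α U) x, x⟫_ℝ = -α * Vpot α U x := by
  rw [← Vpot_fderiv_apply]
  have h1 : HasDerivAt (fun c : ℝ => c • x) x 1 := by
    simpa using (hasDerivAt_id (1:ℝ)).smul_const x
  have h2 : HasFDerivAt (Vpot α U) (fderiv ℝ (Vpot α U) x) ((1:ℝ) • x) := by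
    rw [one_smul]; exact (Vpot_diffAt hUC2 hx).hasFDerivAt
  have h3 := h2.comp_hasDerivAt (1:ℝ) h1
  have h4 : HasDerivAt (fun c : ℝ => c ^ (-α) * Vpot α U x) (-α * Vpot α U x) 1 := by
    have := (Real.hasDerivAt_rpow_const (x := 1) (p := -α) (Or.inl one_ne_zero)).mul_const
      (Vpot α U x)
    simpa using this
  refine h3.unique (h4.congr_of_eventuallyEq ?_)
  filter_upwards [lt_mem_nhds (zero_lt_one (α := ℝ))] with c hc
  exact Vpot_smul x hc

lemma Vpot_lower (hUC2 : ContDiff ℝ 2 U) (hUpos : ∀ s : E2, ‖s‖ = 1 → 0 < U s) :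
    ∃ m, 0 < m ∧ ∀ x : E2, x ≠ 0 → m * ‖x‖ ^ (-α) ≤ Vpot α U x := by
  have hc : IsCompact (Metric.sphere (0:E2) 1) := isCompact_sphere _ _
  have hne : (Metric.sphere (0:E2) 1).Nonempty := NormedSpace.sphere_nonempty.2 zero_le_one
  obtain ⟨x0, hx0, hmin⟩ := hc.exists_isMinOn hne hUC2.continuous.continuousOn
  refine ⟨U x0, hUpos _ (by simpa using hx0), fun x hx => ?_⟩
  unfold Vpot
  rw [mul_comm]
  exact mul_le_mul_of_nonneg_left (hmin (by simpa using unit_norm hx)) (by positivity)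

end basics

lemma du_bois {a b : ℝ} (hab : a < b) {W : ℝ → E2} (hW : IntegrableOn W (Ioo a b))
    (h : ∀ f f' : ℝ → ℝ, (∀ s, HasDerivAt f (f' s) s) → Continuous f' →
      (∀ s, s ∉ Ioo a b → f s = 0) → ∫ s in Ioo a b, f' s • W s = 0) :
    ∃ c : E2, ∀ᵐ s, s ∈ Ioo a b → W s = c := by
  obtain ⟨ψ, hψs, hψc, hψ0, hψ1⟩ : ∃ ψ : ℝ → ℝ, Continuous ψ ∧
      HasCompactSupport ψ ∧ (∀ s, s ∉ Ioo a b → ψ s = 0) ∧ ∫ s, ψ s = 1 := by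
    let B : ContDiffBump ((a+b)/2) := ⟨(b-a)/8, (b-a)/4, by linarith, by linarith⟩
    refine ⟨B.normed volume, B.continuous_normed, B.hasCompactSupport_normed, fun s hs => ?_,
      B.integral_normed⟩
    by_contra hne
    have : s ∈ Function.support (B.normed volume) := hne
    rw [B.support_normed_eq, Metric.mem_ball, Real.dist_eq, abs_lt] at this
    apply hs
    have h4 : B.rOut = (b-a)/4 := rfl
    rw [h4] at this
    constructor <;> linarith [this.1, this.2]
  have bddint : ∀ g : ℝ → ℝ, Continuous g → HasCompactSupport g →
      IntegrableOn (fun s => g s • W s) (Ioo a b) := by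
    intro g hg hgc
    obtain ⟨C, hC⟩ := hgc.exists_bound_of_continuous hg
    exact Integrable.bdd_smul hW C hg.aestronglyMeasurable (Eventually.of_forall hC)
  have key : ∀ g : ℝ → ℝ, Continuous g → HasCompactSupport g → (∀ s, s ∉ Ioo a b → g s = 0) →
      ∫ s in Ioo a b, g s • (W s - ∫ s in Ioo a b, ψ s • W s) = 0 := by
    intro g hg hgc hg0
    set I := ∫ s, g s with hI
    have hgi : Integrable g := hg.integrable_of_hasCompactSupport hgc
    have hψi : Integrable ψ := hψs.integrable_of_hasCompactSupport hψc
    let k := fun s => g s - I * ψ s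
    have hk : Continuous k := hg.sub (continuous_const.mul hψs)
    have hk0 : ∀ s, s ∉ Ioo a b → k s = 0 := fun s hs => by simp [k, hg0 s hs, hψ0 s hs]
    have hkI : ∫ s, k s = 0 := by
      simp only [k]
      rw [integral_sub hgi (hψi.const_mul I), MeasureTheory.integral_const_mul, hψ1, ← hI]; ring
    have hsupp : ∀ g : ℝ → ℝ, (∀ s, s ∉ Ioo a b → g s = 0) → ∫ s in Ioo a b, g s = ∫ s, g s := by
      intro g hg
      exact setIntegral_eq_integral_of_forall_compl_eq_zero hg
    have hkab : ∫ s in a..b, k s = 0 := by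
      rw [integral_of_le hab.le, integral_Ioc_eq_integral_Ioo, hsupp k hk0, hkI]
    have := h (fun s => ∫ t in a..s, k t) k
      (fun s => integral_hasDerivAt_right (hk.intervalIntegrable _ _)
        (hk.stronglyMeasurableAtFilter _ _) hk.continuousAt) hk ?_
    · have e1 : ∀ s, g s • (W s - ∫ s in Ioo a b, ψ s • W s)
          = k s • W s + (I • (ψ s • W s) - g s • ∫ s in Ioo a b, ψ s • W s) := by
        intro s; simp only [k]; module
      simp_rw [e1]
      have i1 : IntegrableOn (fun s => I • (ψ s • W s)) (Ioo a b) := (bddint ψ hψs hψc).smul I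
      have i2 : IntegrableOn (fun s => g s • ∫ s in Ioo a b, ψ s • W s) (Ioo a b) :=
        (hgi.smul_const _).integrableOn
      have i3 : IntegrableOn (fun s => k s • W s) (Ioo a b) := by
        refine ((bddint g hg hgc).sub i1).congr (Eventually.of_forall fun s => ?_)
        simp only [k, Pi.sub_apply]; module
      rw [MeasureTheory.integral_add i3 (Integrable.sub' i1 i2), this,
        MeasureTheory.integral_sub i1 i2, MeasureTheory.integral_smul,
        _root_.integral_smul_const, hsupp g hg0, zero_add, ← hI, sub_self]
    · intro s hs
      rcases lt_or_ge a s with h1 | h1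
      · have h2 : b ≤ s := by by_contra h3; exact hs ⟨h1, not_le.1 h3⟩
        have h3 : ∫ t in b..s, k t = 0 := by
          rw [integral_congr (g := fun _ => 0)]
          · simp
          · intro t ht
            rw [uIcc_of_le h2] at ht
            exact hk0 t (fun h => absurd h.2 (not_lt.2 ht.1))
        rw [← integral_add_adjacent_intervals (hk.intervalIntegrable a b)
          (hk.intervalIntegrable b s), hkab, h3, zero_add]
      · rw [integral_congr (g := fun _ => 0)]
        · simp
        · intro t ht
          rw [uIcc_of_ge h1] at ht
          exact hk0 t (fun h => absurd h.1 (not_lt.2 ht.2))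
  refine ⟨∫ s in Ioo a b, ψ s • W s, ?_⟩
  have hWc : IntegrableOn (fun s => W s - ∫ s in Ioo a b, ψ s • W s) (Ioo a b) :=
    hW.sub (integrableOn_const (by simp))
  have := isOpen_Ioo.ae_eq_zero_of_integral_contDiff_smul_eq_zero (μ := volume)
    hWc.locallyIntegrableOn ?_
  · filter_upwards [this] with s hs h1
    exact sub_eq_zero.1 (hs h1)
  · intro g hg hgc hgs
    have h0 : ∀ s, s ∉ Ioo a b → g s = 0 := fun s hs =>
      image_eq_zero_of_notMem_tsupport (fun h => hs (hgs h))
    rw [← key g hg.continuous hgc h0]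
    exact (setIntegral_eq_integral_of_forall_compl_eq_zero
      (fun s hs => by simp [h0 s hs])).symm

lemma deriv_memLp {T : ℝ} (hT : 0 < T) {u : ℝ → E2}
    (hu : IntervalIntegrable (fun s => ‖deriv u s‖ ^ 2) volume 0 T) :
    MemLp (deriv u) 2 (volume.restrict (Ioo 0 T)) := by
  rw [intervalIntegrable_iff_integrableOn_Ioo_of_le hT.le] at hu
  exact (memLp_two_iff_integrable_sq_norm (measurable_deriv u).aestronglyMeasurable).2 hu

lemma deriv_integrableOn {T : ℝ} (hT : 0 < T) {u : ℝ → E2}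
    (hu : IntervalIntegrable (fun s => ‖deriv u s‖ ^ 2) volume 0 T) :
    IntegrableOn (deriv u) (Ioo 0 T) :=
  (deriv_memLp hT hu).integrable (by norm_num)

lemma first_variation {α h T : ℝ} (hT : 0 < T) {U : E2 → ℝ} (hUC2 : ContDiff ℝ 2 U)
    {q : E2} {u : ℝ → E2} (hadm : AdmPath α h T U q u)
    (hne : ∀ s ∈ Ioo (0:ℝ) T, u s ≠ 0)
    (hmin : ∀ v, AdmPath α h T U q v → MaupertuisT α h T U u ≤ MaupertuisT α h T U v)
    {a b : ℝ} (ha : 0 < a) (hab : a < b) (hb : b < T) {φ φ' : ℝ → E2}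
    (hφ : ∀ s, HasDerivAt φ (φ' s) s) (hφ' : Continuous φ')
    (hφ0 : ∀ s, s ∉ Ioo a b → φ s = 0) :
    (∫ s in (0:ℝ)..T, (h + Vpot α U (u s))) * (∫ s in (0:ℝ)..T, ⟪deriv u s, φ' s⟫_ℝ) +
    ((1/2) * ∫ s in (0:ℝ)..T, ‖deriv u s‖ ^ 2) *
      (∫ s in (0:ℝ)..T, ⟪gradient (Vpot α U) (u s), φ s⟫_ℝ) = 0 := by
  obtain ⟨hcont, hdiff, hu0, huT, hA, hB⟩ := hadm
  have hφc : Continuous φ := continuous_iff_continuousAt.2 fun s => (hφ s).continuousAt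
  have hIcc : Icc a b ⊆ Icc 0 T := Icc_subset_Icc ha.le hb.le
  have hIoo : Icc a b ⊆ Ioo 0 T := fun s hs => ⟨ha.trans_le hs.1, hs.2.trans_lt hb⟩
  have hcab : ContinuousOn u (Icc a b) := hcont.mono hIcc
  obtain ⟨s0, hs0, hs0min⟩ := isCompact_Icc.exists_isMinOn (nonempty_Icc.2 hab.le) hcab.norm
  set δ := ‖u s0‖ with hδ
  have hδ0 : 0 < δ := norm_pos_iff.2 (hne _ (hIoo hs0))
  obtain ⟨R, hR⟩ := isCompact_Icc.exists_bound_of_continuousOn hcab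
  obtain ⟨C0, hC0⟩ := (isCompact_Icc (a := a) (b := b)).exists_bound_of_continuousOn
    hφc.continuousOn
  set C := max C0 1 with hC
  have hCpos : 0 < C := lt_max_of_lt_right one_pos
  have hφC : ∀ s, ‖φ s‖ ≤ C := by
    intro s
    by_cases hs : s ∈ Ioo a b
    · exact (hC0 s (Ioo_subset_Icc_self hs)).trans (le_max_left _ _)
    · rw [hφ0 s hs, norm_zero]; exact hCpos.le
  set ε := δ / (2 * C) with hε
  have hεpos : 0 < ε := by positivity
  have hsm : ∀ x ∈ Metric.ball (0:ℝ) ε, ∀ s, ‖x • φ s‖ ≤ δ / 2 := by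
    intro x hx s
    rw [mem_ball_zero_iff] at hx
    rw [norm_smul]
    calc ‖x‖ * ‖φ s‖ ≤ ε * C := by
          apply mul_le_mul hx.le (hφC s) (norm_nonneg _) hεpos.le
      _ = δ / 2 := by rw [hε]; field_simp
  let K : Set E2 := Metric.closedBall 0 (R + δ / 2) \ Metric.ball 0 (δ / 2)
  have hK : IsCompact K := (isCompact_closedBall _ _).diff Metric.isOpen_ball
  have hK0 : ∀ x ∈ K, x ≠ 0 := by
    rintro x hx rfl
    exact hx.2 (by simpa using hδ0)
  have hwK : ∀ x ∈ Metric.ball (0:ℝ) ε, ∀ s ∈ Icc a b, u s + x • φ s ∈ K := by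
    intro x hx s hs
    have h1 := hsm x hx s
    have h2 : δ ≤ ‖u s‖ := hs0min hs
    have h3 := hR s hs
    refine ⟨?_, ?_⟩
    · rw [mem_closedBall_zero_iff]
      exact (norm_add_le _ _).trans (add_le_add h3 h1)
    · rw [mem_ball_zero_iff, not_lt]
      have h4 := norm_sub_le (u s + x • φ s) (x • φ s)
      rw [add_sub_cancel_right] at h4
      linarith
  have hwne : ∀ x ∈ Metric.ball (0:ℝ) ε, ∀ s ∈ Ioo 0 T, u s + x • φ s ≠ 0 := by
    intro x hx s hs
    by_cases hs' : s ∈ Ioo a b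
    · exact hK0 _ (hwK x hx s (Ioo_subset_Icc_self hs'))
    · rw [hφ0 s hs', smul_zero, add_zero]; exact hne s hs
  obtain ⟨M0, hM0⟩ := hK.exists_bound_of_continuousOn (f := Vpot α U)
    (fun x hx => (Vpot_contAt hUC2 (hK0 x hx)).continuousWithinAt)
  obtain ⟨M1, hM1⟩ := hK.exists_bound_of_continuousOn (f := gradient (Vpot α U))
    (fun x hx => (Vpot_gradient_contAt hUC2 (hK0 x hx)).continuousWithinAt)
  have hucont : ∀ s ∈ Ioo 0 T, ContinuousAt u s := fun s hs => (hdiff s hs).continuousAt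
  have hwcont : ∀ x : ℝ, ∀ s ∈ Ioo 0 T, ContinuousAt (fun s => u s + x • φ s) s := by
    intro x s hs
    have h1 : ContinuousAt (fun s => x • φ s) s := hφc.continuousAt.const_smul x
    exact (hucont s hs).add h1
  have hrestr : volume.restrict (uIoc 0 T) = volume.restrict (Ioo 0 T) := by
    rw [uIoc_of_le hT.le]; exact restrict_Ioo_eq_restrict_Ioc.symm
  have hmeas : ∀ x ∈ Metric.ball (0:ℝ) ε, AEStronglyMeasurable
      (fun s => h + Vpot α U (u s + x • φ s)) (volume.restrict (Ioo 0 T)) := by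
    intro x hx
    refine ContinuousOn.aestronglyMeasurable (fun s hs => ?_) measurableSet_Ioo
    exact (continuousAt_const.add ((Vpot_contAt hUC2 (hwne x hx s hs)).comp
      (f := fun s => u s + x • φ s) (hwcont x s hs))).continuousWithinAt
  have hBint : ∀ x ∈ Metric.ball (0:ℝ) ε, IntervalIntegrable
      (fun s => h + Vpot α U (u s + x • φ s)) volume 0 T := by
    intro x hx
    rw [intervalIntegrable_iff_integrableOn_Ioo_of_le hT.le] at hB ⊢
    refine Integrable.mono' (hB.norm.add (integrable_const (|h| + |M0|))) (hmeas x hx)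
      (Eventually.of_forall fun s => ?_)
    simp only [Pi.add_apply]
    by_cases hs' : s ∈ Ioo a b
    · have h1 := hM0 _ (hwK x hx s (Ioo_subset_Icc_self hs'))
      have h2 := norm_add_le h (Vpot α U (u s + x • φ s))
      have h3 := norm_nonneg (h + Vpot α U (u s))
      have h4 := le_abs_self M0
      rw [Real.norm_eq_abs h] at h2
      linarith
    · rw [hφ0 s hs', smul_zero, add_zero]
      have := abs_nonneg h
      have := abs_nonneg M0
      linarith
  have hball : Metric.ball (0:ℝ) ε ∈ 𝓝 (0:ℝ) := Metric.ball_mem_nhds _ hεpos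
  have h0ball : (0:ℝ) ∈ Metric.ball (0:ℝ) ε := Metric.mem_ball_self hεpos
  have hBder := (hasDerivAt_integral_of_dominated_loc_of_deriv_le (μ := volume) (a := 0) (b := T)
    (F := fun x s => h + Vpot α U (u s + x • φ s))
    (F' := fun x s => ⟪gradient (Vpot α U) (u s + x • φ s), φ s⟫_ℝ) (x₀ := 0)
    (bound := fun _ => |M1| * C) hball
    (by filter_upwards [hball] with x hx; rw [hrestr]; exact hmeas x hx)
    (hBint 0 h0ball) ?_ ?_ (by simp) ?_).2
  rotate_left
  · rw [hrestr]
    refine ContinuousOn.aestronglyMeasurable (fun s hs => ?_) measurableSet_Ioo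
    exact (((Vpot_gradient_contAt hUC2 (hwne 0 h0ball s hs)).comp
      (f := fun s => u s + (0:ℝ) • φ s) (hwcont 0 s hs)).inner hφc.continuousAt).continuousWithinAt
  · refine Eventually.of_forall fun s _ x hx => ?_
    by_cases hs' : s ∈ Ioo a b
    · refine (norm_inner_le_norm _ _).trans ?_
      exact mul_le_mul ((hM1 _ (hwK x hx s (Ioo_subset_Icc_self hs'))).trans (le_abs_self _))
        (hφC s) (norm_nonneg _) (abs_nonneg _)
    · rw [hφ0 s hs', inner_zero_right, norm_zero]; positivity
  · have hT0 : ∀ᵐ s : ℝ, s ≠ T := by simp [ae_iff, measure_singleton]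
    filter_upwards [hT0] with s hsT hs x hx
    rw [uIoc_of_le hT.le] at hs
    have hs2 : s ∈ Ioo 0 T := ⟨hs.1, lt_of_le_of_ne hs.2 hsT⟩
    have h1 : HasDerivAt (fun x : ℝ => u s + x • φ s) (φ s) x := by
      simpa using ((hasDerivAt_id x).smul_const (φ s)).const_add (u s)
    have h2 := (Vpot_diffAt (α := α) hUC2 (hwne x hx s hs2)).hasFDerivAt
    have h3 := (h2.comp_hasDerivAt x h1).const_add h
    rw [Vpot_fderiv_apply] at h3
    exact h3
  simp only [zero_smul, add_zero] at hBder
  have hL2 := deriv_memLp hT hA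
  have hφ'L2 : MemLp φ' 2 (volume.restrict (Ioo 0 T)) := by
    have : IntegrableOn (fun s => ‖φ' s‖ ^ 2) (Ioo 0 T) :=
      ((hφ'.norm.pow 2).integrableOn_Icc (a := 0) (b := T)).mono_set Ioo_subset_Icc_self
    exact (memLp_two_iff_integrable_sq_norm hφ'.aestronglyMeasurable).2 this
  have hi1 : IntervalIntegrable (fun s => ⟪deriv u s, φ' s⟫_ℝ) volume 0 T := by
    rw [intervalIntegrable_iff_integrableOn_Ioo_of_le hT.le]
    refine Integrable.mono' (hL2.integrable_norm_pow (by norm_num) |>.add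
      (hφ'L2.integrable_norm_pow (by norm_num))) (hL2.1.inner hφ'L2.1)
      (Eventually.of_forall fun s => ?_)
    refine (norm_inner_le_norm _ _).trans ?_
    simp only [Pi.add_apply]
    nlinarith [sq_nonneg (‖deriv u s‖ - ‖φ' s‖), sq_nonneg (‖deriv u s‖), sq_nonneg (‖φ' s‖)]
  have hi2 : IntervalIntegrable (fun s => ‖φ' s‖ ^ 2) volume 0 T :=
    (hφ'.norm.pow 2).intervalIntegrable _ _
  have hdw : ∀ x : ℝ, ∀ s ∈ Ioo 0 T, HasDerivAt (fun s => u s + x • φ s) (deriv u s + x • φ' s) s := by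
    intro x s hs
    have h1 : HasDerivAt (fun s => x • φ s) (x • φ' s) s := (hφ s).const_smul x
    exact (hdiff s hs).hasDerivAt.add h1
  have hexp : ∀ x : ℝ, ∀ s ∈ Ioo 0 T, ‖deriv (fun s => u s + x • φ s) s‖ ^ 2 =
      ‖deriv u s‖ ^ 2 + 2 * x * ⟪deriv u s, φ' s⟫_ℝ + x ^ 2 * ‖φ' s‖ ^ 2 := by
    intro x s hs
    rw [(hdw x s hs).deriv, norm_add_sq_real, inner_smul_right, norm_smul, mul_pow,
      Real.norm_eq_abs, sq_abs]
    ring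
  have hi3 : ∀ x : ℝ, IntervalIntegrable (fun s => ‖deriv u s‖ ^ 2 +
      2 * x * ⟪deriv u s, φ' s⟫_ℝ + x ^ 2 * ‖φ' s‖ ^ 2) volume 0 T := fun x =>
    (hA.add (hi1.const_mul _)).add (hi2.const_mul _)
  have hi4 : ∀ x : ℝ, IntervalIntegrable
      (fun s => ‖deriv (fun s => u s + x • φ s) s‖ ^ 2) volume 0 T := by
    intro x
    have := hi3 x
    rw [intervalIntegrable_iff_integrableOn_Ioo_of_le hT.le] at this ⊢
    exact this.congr_fun (fun s hs => (hexp x s hs).symm) measurableSet_Ioo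
  have hAx : ∀ x : ℝ, ∫ s in (0:ℝ)..T, ‖deriv (fun s => u s + x • φ s) s‖ ^ 2 =
      (∫ s in (0:ℝ)..T, ‖deriv u s‖ ^ 2) + 2 * x * (∫ s in (0:ℝ)..T, ⟪deriv u s, φ' s⟫_ℝ)
      + x ^ 2 * ∫ s in (0:ℝ)..T, ‖φ' s‖ ^ 2 := by
    intro x
    rw [← intervalIntegral.integral_const_mul, ← intervalIntegral.integral_const_mul,
      ← intervalIntegral.integral_add hA (hi1.const_mul _),
      ← intervalIntegral.integral_add (hA.add (hi1.const_mul _)) (hi2.const_mul _)]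
    rw [integral_of_le hT.le, integral_of_le hT.le, integral_Ioc_eq_integral_Ioo,
      integral_Ioc_eq_integral_Ioo]
    exact setIntegral_congr_fun measurableSet_Ioo (fun s hs => hexp x s hs)
  have hAder : HasDerivAt (fun x : ℝ =>
      (1/2) * ∫ s in (0:ℝ)..T, ‖deriv (fun s => u s + x • φ s) s‖ ^ 2)
      (∫ s in (0:ℝ)..T, ⟪deriv u s, φ' s⟫_ℝ) 0 := by
    simp_rw [hAx]
    generalize (∫ s in (0:ℝ)..T, ‖deriv u s‖ ^ 2) = c1
    generalize (∫ s in (0:ℝ)..T, ⟪deriv u s, φ' s⟫_ℝ) = c2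
    generalize (∫ s in (0:ℝ)..T, ‖φ' s‖ ^ 2) = c3
    have := (((((hasDerivAt_id (0:ℝ)).const_mul 2).mul_const c2).const_add c1).add
      (((hasDerivAt_id (0:ℝ)).pow 2).mul_const c3)).const_mul (1/2)
    refine this.congr_deriv ?_ |>.congr_of_eventuallyEq (Eventually.of_forall fun x => ?_)
    · simp
    · simp
  have hprod := hAder.mul hBder
  have hlm : IsLocalMin (fun x : ℝ => MaupertuisT α h T U (fun s => u s + x • φ s)) 0 := by
    filter_upwards [hball] with x hx
    simp only [zero_smul, add_zero]
    refine hmin _ ⟨?_, fun s hs => (hdw x s hs).differentiableAt, ?_, ?_, hi4 x, hBint x hx⟩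
    · exact hcont.add (hφc.const_smul x).continuousOn
    · simp only
      rw [hφ0 0 (fun h => absurd h.1 (not_lt.2 ha.le)), hu0]; simp
    · simp only
      rw [hφ0 T (fun h => absurd h.2 (not_lt.2 hb.le)), huT]; simp
  have := hlm.hasDerivAt_eq_zero hprod
  simp only [zero_smul, add_zero] at this
  linarith

lemma el_solution {α h T : ℝ} (hT : 0 < T) {U : E2 → ℝ} (hUC2 : ContDiff ℝ 2 U)
    {q : E2} {u : ℝ → E2} (hadm : AdmPath α h T U q u)
    (hne : ∀ s ∈ Ioo (0:ℝ) T, u s ≠ 0)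
    (hmin : ∀ v, AdmPath α h T U q v → MaupertuisT α h T U u ≤ MaupertuisT α h T U v)
    {A B : ℝ} (hBpos : 0 < B) (hAdef : A = (1/2) * ∫ s in (0:ℝ)..T, ‖deriv u s‖ ^ 2)
    (hBdef : B = ∫ s in (0:ℝ)..T, (h + Vpot α U (u s))) :
    ∀ t ∈ Ioo 0 T, HasDerivAt (deriv u) ((A / B) • gradient (Vpot α U) (u t)) t := by
  intro t ht
  obtain ⟨a, ha, hat⟩ := exists_between ht.1
  obtain ⟨b, htb, hb⟩ := exists_between ht.2
  have hab : a < b := hat.trans htb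
  have hIoo : Icc a b ⊆ Ioo 0 T := fun s hs => ⟨ha.trans_le hs.1, hs.2.trans_lt hb⟩
  have hIoo' : Ioo a b ⊆ Ioo 0 T := Ioo_subset_Icc_self.trans hIoo
  have hdiff := hadm.2.1
  let p : ℝ → ℝ := fun s => max a (min b s)
  have hpc : Continuous p := by fun_prop
  have hp : ∀ s, p s ∈ Icc a b := fun s =>
    ⟨le_max_left _ _, max_le hab.le (min_le_left _ _)⟩
  have hpid : ∀ s ∈ Icc a b, p s = s := fun s hs => by
    simp only [p]; rw [min_eq_right hs.2, max_eq_right hs.1]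
  let g : ℝ → E2 := fun s => gradient (Vpot α U) (u (p s))
  have hg : Continuous g := continuous_iff_continuousAt.2 fun s =>
    (Vpot_gradient_contAt hUC2 (hne _ (hIoo (hp s)))).comp (f := fun s => u (p s))
      ((hdiff _ (hIoo (hp s))).continuousAt.comp (f := p) hpc.continuousAt)
  have hgeq : ∀ s ∈ Icc a b, g s = gradient (Vpot α U) (u s) := fun s hs => by
    simp only [g]; rw [hpid s hs]
  let G : ℝ → E2 := fun s => ∫ τ in a..s, g τ
  have hG : ∀ s, HasDerivAt G (g s) s := fun s =>
    integral_hasDerivAt_right (hg.intervalIntegrable _ _)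
        (hg.stronglyMeasurableAtFilter _ _) hg.continuousAt
  have hGc : Continuous G := continuous_iff_continuousAt.2 fun s => (hG s).continuousAt
  have hdi : IntegrableOn (deriv u) (Ioo a b) :=
    (deriv_integrableOn hT hadm.2.2.2.2.1).mono_set hIoo'
  have contint : ∀ k : ℝ → E2, Continuous k → IntegrableOn k (Ioo a b) := fun k hk =>
    (hk.integrableOn_Icc (a := a) (b := b)).mono_set Ioo_subset_Icc_self
  have hW : IntegrableOn (fun s => B • deriv u s - A • G s) (Ioo a b) :=
    Integrable.sub' (hdi.smul B) ((contint G hGc).smul A)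
  obtain ⟨c, hc⟩ := du_bois hab hW (by
    intro f f' hf hf' hf0
    have hfc : Continuous f := continuous_iff_continuousAt.2 fun s => (hf s).continuousAt
    have hf'0 : ∀ s, s ∉ Icc a b → f' s = 0 := by
      intro s hs
      refine (hf s).unique ((hasDerivAt_const s (0:ℝ)).congr_of_eventuallyEq ?_)
      filter_upwards [isClosed_Icc.isOpen_compl.mem_nhds hs] with r hr
      exact hf0 r (fun h => hr (Ioo_subset_Icc_self h))
    have hfu : IntegrableOn (fun s => f' s • deriv u s) (Ioo a b) := by
      obtain ⟨C, hC⟩ := (isCompact_Icc (a := a) (b := b)).exists_bound_of_continuousOn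
        hf'.continuousOn
      refine Integrable.bdd_smul hdi C hf'.aestronglyMeasurable ?_
      filter_upwards [ae_restrict_mem measurableSet_Ioo] with s hs
      exact hC s (Ioo_subset_Icc_self hs)
    have hfG : IntegrableOn (fun s => f' s • G s) (Ioo a b) := contint _ (hf'.smul hGc)
    have hfg : IntegrableOn (fun s => f s • g s) (Ioo a b) := contint _ (hfc.smul hg)
    have ibp : (∫ s in Ioo a b, f' s • G s) = - ∫ s in Ioo a b, f s • g s := by
      have h1 := integral_eq_sub_of_hasDerivAt (a := a) (b := b)
        (f := fun s => f s • G s) (f' := fun s => f s • g s + f' s • G s)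
        (fun s _ => (hf s).smul (hG s))
        (((hfc.smul hg).add (hf'.smul hGc)).intervalIntegrable _ _)
      rw [integral_of_le hab.le, integral_Ioc_eq_integral_Ioo, MeasureTheory.integral_add hfg hfG,
        hf0 a (fun h => lt_irrefl _ h.1), hf0 b (fun h => lt_irrefl _ h.2)] at h1
      simp only [zero_smul, sub_zero] at h1
      rw [add_comm] at h1
      exact eq_neg_of_add_eq_zero_left h1
    have e1 : (∫ s in Ioo a b, f' s • (B • deriv u s - A • G s)) =
        B • (∫ s in Ioo a b, f' s • deriv u s) + A • ∫ s in Ioo a b, f s • g s := by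
      have : ∀ s, f' s • (B • deriv u s - A • G s) = B • (f' s • deriv u s) - A • (f' s • G s) :=
        fun s => by module
      simp_rw [this]
      have i1 : IntegrableOn (fun s => B • (f' s • deriv u s)) (Ioo a b) := hfu.smul B
      have i2 : IntegrableOn (fun s => A • (f' s • G s)) (Ioo a b) := hfG.smul A
      rw [MeasureTheory.integral_sub i1 i2, MeasureTheory.integral_smul,
        MeasureTheory.integral_smul, ibp, smul_neg, sub_neg_eq_add]
    rw [e1]
    refine ext_inner_left ℝ fun e => ?_
    rw [inner_zero_right, inner_add_right, inner_smul_right, inner_smul_right,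
      ← integral_inner hfu, ← integral_inner hfg]
    have fv := first_variation hT hUC2 hadm hne hmin ha hab hb (φ := fun s => f s • e)
      (φ' := fun s => f' s • e) (fun s => (hf s).smul_const e) (hf'.smul continuous_const)
      (fun s hs => by simp [hf0 s hs])
    rw [← hAdef, ← hBdef] at fv
    have conv : ∀ k l : ℝ → ℝ, (∀ s, s ∉ Icc a b → k s = 0) → (∀ s ∈ Ioo a b, k s = l s) →
        ∫ s in (0:ℝ)..T, k s = ∫ s in Ioo a b, l s := by
      intro k l hk hkl
      rw [integral_of_le hT.le, integral_Ioc_eq_integral_Ioo,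
        ← setIntegral_congr_fun measurableSet_Ioo hkl,
        show ∫ s in Ioo a b, k s = ∫ s in Icc a b, k s from integral_Icc_eq_integral_Ioo.symm]
      exact setIntegral_eq_of_subset_of_forall_sdiff_eq_zero measurableSet_Ioo hIoo
        (fun s hs => hk s hs.2)
    rw [conv _ (fun s => ⟪e, f' s • deriv u s⟫_ℝ), conv _ (fun s => ⟪e, f s • g s⟫_ℝ)] at fv
    · exact fv
    · intro s hs; simp [hf0 s (fun h => hs (Ioo_subset_Icc_self h))]
    · intro s hs
      rw [hgeq s (Ioo_subset_Icc_self hs), inner_smul_right, inner_smul_right, real_inner_comm]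
    · intro s hs; simp [hf'0 s hs]
    · intro s hs
      rw [inner_smul_right, inner_smul_right, real_inner_comm])
  let k : ℝ → E2 := fun s => B⁻¹ • (A • G s + c)
  have hk : Continuous k := by fun_prop
  have hku : ∀ᵐ s, s ∈ Ioo a b → deriv u s = k s := by
    filter_upwards [hc] with s hs h1
    have := hs h1
    simp only [k]
    rw [← this, add_sub_cancel, smul_smul, inv_mul_cancel₀ hBpos.ne', one_smul]
  have huk : ∀ s ∈ Ioo a b, u s = u a + ∫ τ in a..s, k τ := by
    intro s hs
    have h1 : ∫ τ in a..s, deriv u τ = u s - u a := by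
      refine integral_eq_sub_of_hasDerivAt (fun τ hτ => ?_) ?_
      · rw [uIcc_of_le hs.1.le] at hτ
        exact (hdiff τ (hIoo ⟨hτ.1, hτ.2.trans hs.2.le⟩)).hasDerivAt
      · rw [intervalIntegrable_iff_integrableOn_Ioo_of_le hs.1.le]
        exact hdi.mono_set (Ioo_subset_Ioo_right hs.2.le)
    have h2 : ∫ τ in a..s, deriv u τ = ∫ τ in a..s, k τ := by
      refine integral_congr_ae ?_
      filter_upwards [hku] with τ hτ h3
      rw [uIoc_of_le hs.1.le] at h3
      exact hτ ⟨h3.1, h3.2.trans_lt hs.2⟩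
    rw [← h2, h1]; abel
  have hdk : ∀ s ∈ Ioo a b, deriv u s = k s := by
    intro s hs
    have h1 : HasDerivAt (fun s => u a + ∫ τ in a..s, k τ) (k s) s :=
      (integral_hasDerivAt_right (hk.intervalIntegrable _ _)
        (hk.stronglyMeasurableAtFilter _ _) hk.continuousAt).const_add _
    refine (h1.congr_of_eventuallyEq ?_).deriv
    filter_upwards [Ioo_mem_nhds hs.1 hs.2] with r hr using huk r hr
  have hkd : HasDerivAt k (B⁻¹ • (A • g t)) t :=
    (((hG t).const_smul A).add_const c).const_smul B⁻¹
  rw [hgeq t ⟨hat.le, htb.le⟩, smul_smul, mul_comm, ← div_eq_mul_inv] at hkd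
  refine hkd.congr_of_eventuallyEq ?_
  filter_upwards [Ioo_mem_nhds hat htb] with r hr using hdk r hr

lemma energy_solution {α h T : ℝ} (hT : 0 < T) {U : E2 → ℝ} (hUC2 : ContDiff ℝ 2 U)
    {q : E2} {u : ℝ → E2} (hadm : AdmPath α h T U q u)
    (hne : ∀ s ∈ Ioo (0:ℝ) T, u s ≠ 0)
    (hmin : ∀ v, AdmPath α h T U q v → MaupertuisT α h T U u ≤ MaupertuisT α h T U v)
    {A B : ℝ} (hApos : 0 < A) (hBpos : 0 < B)
    (hAdef : A = (1/2) * ∫ s in (0:ℝ)..T, ‖deriv u s‖ ^ 2)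
    (hBdef : B = ∫ s in (0:ℝ)..T, (h + Vpot α U (u s))) :
    ∀ t ∈ Ioo 0 T, (1/2) * (B / A * ‖deriv u t‖ ^ 2) - Vpot α U (u t) = h := by
  have hel := el_solution hT hUC2 hadm hne hmin hBpos hAdef hBdef
  obtain ⟨hcont, hdiff, hu0, huT, hA, hB⟩ := hadm
  set E : ℝ → ℝ := fun t => (1/2) * (B / A * ‖deriv u t‖ ^ 2) - Vpot α U (u t) with hE
  have hEd : ∀ t ∈ Ioo 0 T, HasDerivAt E 0 t := by
    intro t ht
    have h1 := ((hel t ht).norm_sq.const_mul (B / A)).const_mul (1/2)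
    have h2 := (Vpot_diffAt (α := α) hUC2 (hne t ht)).hasFDerivAt.comp_hasDerivAt t
      (hdiff t ht).hasDerivAt
    rw [Vpot_fderiv_apply] at h2
    have h3 := h1.sub h2
    have h4 : (1 / 2 * (B / A * (2 * ⟪deriv u t, (A / B) • gradient (Vpot α U) (u t)⟫_ℝ)) -
      ⟪gradient (Vpot α U) (u t), deriv u t⟫_ℝ) = 0 := by
      rw [inner_smul_right, real_inner_comm]
      field_simp
      ring
    rw [h4] at h3
    exact h3
  have hm : T / 2 ∈ Ioo 0 T := ⟨by linarith, by linarith⟩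
  have hconst : ∀ t ∈ Ioo 0 T, E t = E (T / 2) := by
    intro t ht
    exact isOpen_Ioo.is_const_of_deriv_eq_zero isPreconnected_Ioo
      (fun s hs => (hEd s hs).differentiableAt.differentiableWithinAt)
      (fun s hs => (hEd s hs).deriv) ht hm
  have hV : IntervalIntegrable (fun s => Vpot α U (u s)) volume 0 T := by
    have := hB.sub (intervalIntegrable_const (c := h))
    refine this.congr (fun s _ => ?_)
    simp
  have hintg : ∫ s in (0:ℝ)..T, E s = T * E (T / 2) := by
    rw [integral_of_le hT.le, integral_Ioc_eq_integral_Ioo,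
      setIntegral_congr_fun measurableSet_Ioo hconst]
    simp [hT.le]
  have h1 : ∫ s in (0:ℝ)..T, E s = B / A * A - ∫ s in (0:ℝ)..T, Vpot α U (u s) := by
    simp only [hE]
    rw [intervalIntegral.integral_sub ((hA.const_mul _).const_mul _) hV,
      intervalIntegral.integral_const_mul, intervalIntegral.integral_const_mul]
    rw [hAdef]; ring
  have h2 : B = T * h + ∫ s in (0:ℝ)..T, Vpot α U (u s) := by
    rw [hBdef, intervalIntegral.integral_add intervalIntegrable_const hV]
    simp
  have h3 : T * E (T / 2) = T * h := by
    rw [← hintg, h1, div_mul_cancel₀ _ hApos.ne']; linarith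
  intro t ht
  have h4 := hconst t ht
  rw [mul_left_cancel₀ hT.ne' h3] at h4
  exact h4

lemma neg_energy {α h T : ℝ} (hα : 0 < α) (hT : 0 < T) {U : E2 → ℝ}
    (hUpos : ∀ s : E2, ‖s‖ = 1 → 0 < U s)
    {q : E2} {u : ℝ → E2} (hadm : AdmPath α h T U q u) (hh : h < 0) :
    ∃ v, AdmPath α h T U q v ∧ MaupertuisT α h T U v ≤ 0 := by
  obtain ⟨hcont, hdiff, hu0, huT, hA, hB⟩ := hadm
  have hV : IntervalIntegrable (fun s => Vpot α U (u s)) volume 0 T := by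
    have := hB.sub (intervalIntegrable_const (c := h))
    refine this.congr (fun s _ => ?_)
    simp
  let v : ℕ → ℝ → E2 := fun n s => (1 + n * s) • u s
  have hVv : ∀ n : ℕ, ∀ s : ℝ, 0 ≤ s →
      Vpot α U (v n s) = (1 + n * s) ^ (-α) * Vpot α U (u s) :=
    fun n s hs => Vpot_smul _ (by positivity)
  have hintg : ∀ n : ℕ, IntervalIntegrable (fun s => Vpot α U (v n s)) volume 0 T := by
    intro n
    have hc : ContinuousOn (fun s : ℝ => (1 + n * s) ^ (-α)) (uIcc 0 T) := by
      rw [uIcc_of_le hT.le]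
      intro s hs
      have hs0 := hs.1
      refine ContinuousAt.continuousWithinAt ?_
      refine ContinuousAt.rpow_const (by fun_prop) (Or.inl ?_)
      positivity
    refine (hV.continuousOn_mul hc).congr (fun s hs => ?_)
    rw [uIoc_of_le hT.le] at hs
    exact (hVv n s hs.1.le).symm
  have hlim : Tendsto (fun n : ℕ => ∫ s in (0:ℝ)..T, Vpot α U (v n s)) atTop
      (𝓝 (∫ s in (0:ℝ)..T, (0:ℝ))) := by
    refine intervalIntegral.tendsto_integral_filter_of_dominated_convergence
      (fun s => Vpot α U (u s)) ?_ ?_ hV ?_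
    · exact Eventually.of_forall fun n => (intervalIntegrable_iff.1 (hintg n)).aestronglyMeasurable
    · refine Eventually.of_forall fun n => Eventually.of_forall fun s hs => ?_
      rw [uIoc_of_le hT.le] at hs
      have hs0 := hs.1
      rw [hVv n s hs.1.le, Real.norm_of_nonneg (mul_nonneg (by positivity)
        (Vpot_nonneg hα hUpos _))]
      refine mul_le_of_le_one_left (Vpot_nonneg hα hUpos _) ?_
      refine Real.rpow_le_one_of_one_le_of_nonpos ?_ (by linarith)
      have : 0 ≤ (n:ℝ) * s := by positivity
      linarith
    · refine Eventually.of_forall fun s hs => ?_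
      rw [uIoc_of_le hT.le] at hs
      have h1 : Tendsto (fun n : ℕ => 1 + (n:ℝ) * s) atTop atTop :=
        tendsto_atTop_add_const_left _ _ (tendsto_natCast_atTop_atTop.atTop_mul_const hs.1)
      have h2 := ((tendsto_rpow_neg_atTop hα).comp h1).mul_const (Vpot α U (u s))
      rw [zero_mul] at h2
      exact h2.congr fun n => (hVv n s hs.1.le).symm
  simp only [intervalIntegral.integral_zero] at hlim
  have hev := hlim.eventually (gt_mem_nhds (show (0:ℝ) < -(h * T) by nlinarith))
  obtain ⟨n, hn⟩ := hev.exists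
  have hdv : ∀ s ∈ Ioo 0 T, HasDerivAt (v n) ((1 + n * s) • deriv u s + (n:ℝ) • u s) s := by
    intro s hs
    have h1 : HasDerivAt (fun s : ℝ => 1 + (n:ℝ) * s) (n:ℝ) s := by
      simpa using ((hasDerivAt_id s).const_mul (n:ℝ)).const_add 1
    exact h1.smul (hdiff s hs).hasDerivAt
  refine ⟨v n, ⟨?_, fun s hs => (hdv s hs).differentiableAt, ?_, ?_, ?_, ?_⟩, ?_⟩
  · have h1 : ContinuousOn (fun s : ℝ => 1 + (n:ℝ) * s) (Icc 0 T) := by fun_prop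
    exact h1.smul hcont
  · simp [v, hu0]
  · simp [v, huT]
  · obtain ⟨R, hR⟩ := isCompact_Icc.exists_bound_of_continuousOn hcont
    rw [intervalIntegrable_iff_integrableOn_Ioo_of_le hT.le] at hA ⊢
    have hi : IntegrableOn (fun s => 2 * (1 + n * T) ^ 2 * ‖deriv u s‖ ^ 2
        + 2 * (n:ℝ) ^ 2 * R ^ 2) (Ioo 0 T) :=
      Integrable.add (hA.const_mul _) (integrable_const _)
    refine Integrable.mono' hi (((measurable_deriv _).norm.pow_const 2).aestronglyMeasurable) ?_
    filter_upwards [ae_restrict_mem measurableSet_Ioo] with s hs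
    rw [(hdv s hs).deriv, Real.norm_of_nonneg (by positivity)]
    have hs0 := hs.1
    have h1 := norm_add_le ((1 + n * s) • deriv u s) ((n:ℝ) • u s)
    rw [norm_smul, norm_smul, Real.norm_of_nonneg (by positivity : 0 ≤ 1 + (n:ℝ) * s),
      Real.norm_of_nonneg (by positivity : 0 ≤ (n:ℝ))] at h1
    have h2 : (1 + n * s) * ‖deriv u s‖ ≤ (1 + n * T) * ‖deriv u s‖ := by
      have := hs.2.le
      gcongr
    have h3 : (n:ℝ) * ‖u s‖ ≤ n * R := by
      have := hR s (Ioo_subset_Icc_self hs)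
      gcongr
    have h4 := h1.trans (add_le_add h2 h3)
    have h5 := pow_le_pow_left₀ (norm_nonneg _) h4 2
    refine h5.trans ?_
    nlinarith [sq_nonneg ((1 + n * T) * ‖deriv u s‖ - n * R)]
  · exact intervalIntegrable_const.add (hintg n)
  · refine mul_nonpos_of_nonneg_of_nonpos ?_ ?_
    · have : 0 ≤ ∫ s in (0:ℝ)..T, ‖deriv (v n) s‖ ^ 2 :=
        integral_nonneg hT.le (fun s _ => by positivity)
      linarith
    · rw [intervalIntegral.integral_add intervalIntegrable_const (hintg n)]
      simp only [intervalIntegral.integral_const, sub_zero, smul_eq_mul]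
      linarith

lemma no_diff_collision {α h T κ C : ℝ} (hα : α ∈ Ioo (0:ℝ) 2) (hT : 0 < T) {U : E2 → ℝ}
    (hUC2 : ContDiff ℝ 2 U) (hUpos : ∀ s : E2, ‖s‖ = 1 → 0 < U s) (hh : 0 ≤ h)
    {v : ℝ → E2} (hcont : ContinuousOn v (Icc 0 T)) (hvT : v T = 0)
    (hne : ∀ s ∈ Ioo (0:ℝ) T, v s ≠ 0) (hκ : 0 < κ)
    (hdiff : ∀ s ∈ Ioo (0:ℝ) T, DifferentiableAt ℝ v s)
    (hel : ∀ s ∈ Ioo (0:ℝ) T, HasDerivAt (deriv v) (κ • gradient (Vpot α U) (v s)) s)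
    (hen : ∀ s ∈ Ioo (0:ℝ) T, ‖deriv v s‖ ^ 2 = 2 * κ * (h + Vpot α U (v s)))
    (hC : ∀ᶠ s in 𝓝[<] T, ‖v s‖ ≤ C * (T - s)) : False := by
  obtain ⟨m, hm, hlow⟩ := Vpot_lower (α := α) hUC2 hUpos
  set N := 2 * C ^ 2 + 1 with hN
  have hN1 : 1 ≤ N := by nlinarith [sq_nonneg C]
  have hv0 : Tendsto v (𝓝[<] T) (𝓝 0) := by
    have h1 := hcont T ⟨hT.le, le_rfl⟩
    unfold ContinuousWithinAt at h1
    rw [hvT] at h1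
    refine h1.mono_left ?_
    rw [← nhdsWithin_Ioo_eq_nhdsLT hT]
    exact nhdsWithin_mono _ Ioo_subset_Icc_self
  have hmem : ∀ᶠ s in 𝓝[<] T, s ∈ Ioo 0 T := Ioo_mem_nhdsLT hT
  have hVinf : Tendsto (fun s => m * ‖v s‖ ^ (-α)) (𝓝[<] T) atTop := by
    refine Tendsto.const_mul_atTop hm ?_
    refine (tendsto_rpow_neg_nhdsGT_zero (neg_lt_zero.2 hα.1)).comp ?_
    refine tendsto_nhdsWithin_iff.2 ⟨by simpa using hv0.norm, ?_⟩
    filter_upwards [hmem] with s hs using norm_pos_iff.2 (hne s hs)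
  have hαp : 0 < 4 - 2 * α := by linarith [hα.2]
  have hall := (hmem.and hC).and (hVinf.eventually_ge_atTop (N / (κ * (4 - 2 * α))))
  obtain ⟨T0, hT0, hsub⟩ := (mem_nhdsLT_iff_exists_Ioo_subset).1 hall
  obtain ⟨s, hs0, hsT⟩ := exists_between (show T0 < T from hT0)
  have hsub' : ∀ t ∈ Ico s T, t ∈ Ioo 0 T ∧ ‖v t‖ ≤ C * (T - t) ∧ N ≤ κ * (4 - 2 * α) *
      Vpot α U (v t) := by
    intro t ht
    obtain ⟨⟨h1, h2⟩, h3⟩ := hsub ⟨hs0.trans_le ht.1, ht.2⟩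
    refine ⟨h1, h2, ?_⟩
    have h4 := h3.trans (hlow _ (hne t h1))
    rw [div_le_iff₀ (by positivity)] at h4
    linarith
  have hs := (hsub' s ⟨le_rfl, hsT⟩).1
  let J : ℝ → ℝ := fun t => ‖v t‖ ^ 2 - N / 2 * (T - t) ^ 2
  have hconv : ConvexOn ℝ (Icc s T) J := by
    refine convexOn_of_hasDerivWithinAt2_nonneg (convex_Icc _ _)
      (f' := fun t => 2 * ⟪v t, deriv v t⟫_ℝ + N * (T - t))
      (f'' := fun t => 2 * (⟪v t, κ • gradient (Vpot α U) (v t)⟫_ℝ + ⟪deriv v t, deriv v t⟫_ℝ) - N)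
      ?_ ?_ ?_ ?_
    · have : ContinuousOn v (Icc s T) := hcont.mono (Icc_subset_Icc_left hs.1.le)
      exact (this.norm.pow 2).sub (by fun_prop)
    · intro t ht
      rw [interior_Icc] at ht
      have ht' := (hsub' t ⟨ht.1.le, ht.2⟩).1
      have h1 : HasDerivAt (fun t : ℝ => N / 2 * (T - t) ^ 2) (-(N * (T - t))) t := by
        have := (((hasDerivAt_id t).const_sub T).pow 2).const_mul (N / 2)
        convert! this using 1
        simp; ring
      have h2 := ((hdiff t ht').hasDerivAt.norm_sq).sub h1
      rw [sub_neg_eq_add] at h2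
      exact h2.hasDerivWithinAt
    · intro t ht
      rw [interior_Icc] at ht
      have ht' := (hsub' t ⟨ht.1.le, ht.2⟩).1
      have h1 : HasDerivAt (fun t : ℝ => N * (T - t)) (-N) t := by
        have := ((hasDerivAt_id t).const_sub T).const_mul N
        convert! this using 1
        simp
      have h2 := (((hdiff t ht').hasDerivAt.inner ℝ (hel t ht')).const_mul 2).add h1
      rw [← sub_eq_add_neg] at h2
      exact h2.hasDerivWithinAt
    · intro t ht
      rw [interior_Icc] at ht
      obtain ⟨ht', -, h3⟩ := hsub' t ⟨ht.1.le, ht.2⟩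
      rw [inner_smul_right, real_inner_comm, Vpot_euler hUC2 (hne t ht'),
        real_inner_self_eq_norm_sq, hen t ht']
      have : 0 ≤ κ * h := by positivity
      nlinarith
  have hJT : J T = 0 := by simp [J, hvT]
  set a := 1 / (2 * N) with ha
  have ha0 : 0 < a := by positivity
  have haN : a * N = 1 / 2 := by rw [ha]; field_simp
  have ha1 : a < 1 := by nlinarith
  have hc := hconv.2 (left_mem_Icc.2 hsT.le) (right_mem_Icc.2 hsT.le) ha0.le
    (sub_nonneg.2 ha1.le) (by ring)
  simp only [smul_eq_mul, hJT, mul_zero, add_zero] at hc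
  have hlowJ : -(N / 2 * (a * (T - s)) ^ 2) ≤ J (a * s + (1 - a) * T) := by
    simp only [J]
    have e : T - (a * s + (1 - a) * T) = a * (T - s) := by ring
    rw [e]
    have := sq_nonneg ‖v (a * s + (1 - a) * T)‖
    linarith
  have hupJ : J s ≤ - (1/2) * (T - s) ^ 2 := by
    simp only [J]
    have h1 := pow_le_pow_left₀ (norm_nonneg _) (hsub' s ⟨le_rfl, hsT⟩).2.1 2
    rw [mul_pow] at h1
    rw [hN]
    linarith
  have hd : 0 < (T - s) ^ 2 := by have := sub_pos.2 hsT; positivity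
  have h5 : -(N / 2 * (a * (T - s)) ^ 2) = a * (-(1/4) * (T - s) ^ 2) := by
    linear_combination (-(1/2) * a * (T - s)^2) * haN
  rw [h5] at hlowJ
  have h6 := le_of_mul_le_mul_left (hlowJ.trans hc) ha0
  linarith

lemma AB_pos {α h T : ℝ} (hT : 0 < T) {U : E2 → ℝ} {u : ℝ → E2}
    (hpos : 0 < MaupertuisT α h T U u) :
    0 < (1/2) * (∫ s in (0:ℝ)..T, ‖deriv u s‖ ^ 2) ∧
      0 < ∫ s in (0:ℝ)..T, (h + Vpot α U (u s)) := by
  have hA : 0 ≤ (1/2) * (∫ s in (0:ℝ)..T, ‖deriv u s‖ ^ 2) := by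
    have := intervalIntegral.integral_nonneg (μ := volume) (f := fun s => ‖deriv u s‖ ^ 2) hT.le
      (fun s _ => by positivity)
    linarith
  unfold MaupertuisT at hpos
  have hA' : 0 < (1/2) * (∫ s in (0:ℝ)..T, ‖deriv u s‖ ^ 2) := by
    rcases hA.lt_or_eq with h1 | h1
    · exact h1
    · rw [← h1, zero_mul] at hpos
      exact absurd hpos (lt_irrefl _)
  exact ⟨hA', (pos_iff_pos_of_mul_pos hpos).1 hA'⟩

lemma no_interior_zero {α h T : ℝ} (hα : α ∈ Ioo (0:ℝ) 2) (hT : 0 < T) {U : E2 → ℝ}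
    (hUC2 : ContDiff ℝ 2 U) (hUpos : ∀ s : E2, ‖s‖ = 1 → 0 < U s) (hh : 0 ≤ h)
    {q : E2} (hq : q ≠ 0) {u : ℝ → E2} (hadm : AdmPath α h T U q u)
    (hmin : ∀ v, AdmPath α h T U q v → MaupertuisT α h T U u ≤ MaupertuisT α h T U v)
    (hpos : 0 < MaupertuisT α h T U u) : ∀ s ∈ Ioo (0:ℝ) T, u s ≠ 0 := by
  intro s₀ hs₀ hus₀
  obtain ⟨hcont, hdiff, hu0, huT, hA, hB⟩ := hadm
  have hclosed : IsClosed (Icc 0 T ∩ u ⁻¹' {0}) :=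
    hcont.preimage_isClosed_of_isClosed isClosed_Icc isClosed_singleton
  have hcomp : IsCompact (Icc 0 T ∩ u ⁻¹' {0}) :=
    isCompact_Icc.of_isClosed_subset hclosed inter_subset_left
  obtain ⟨T1, ⟨hT1I, hT1z⟩, hT1least⟩ :=
    hcomp.exists_isLeast ⟨s₀, ⟨hs₀.1.le, hs₀.2.le⟩, hus₀⟩
  have hT1z' : u T1 = 0 := hT1z
  have hT1T : T1 < T := (hT1least ⟨⟨hs₀.1.le, hs₀.2.le⟩, hus₀⟩).trans_lt hs₀.2
  have hT1pos : 0 < T1 := by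
    rcases hT1I.1.lt_or_eq with h1 | h1
    · exact h1
    · rw [← h1, hu0] at hT1z'
      exact absurd hT1z' hq
  have hune : ∀ s, 0 ≤ s → s < T1 → u s ≠ 0 := fun s hs hs1 hz =>
    absurd (hT1least ⟨⟨hs, (hs1.trans hT1T).le⟩, hz⟩) (not_le.2 hs1)
  set c := T1 / T with hc
  have hcpos : 0 < c := by positivity
  have hcT : c * T = T1 := by rw [hc]; field_simp
  have hc1 : c < 1 := by rw [hc, div_lt_one hT]; exact hT1T
  have hmaps : ∀ s ∈ Ioo (0:ℝ) T, 0 < c * s ∧ c * s < T1 := fun s hs =>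
    ⟨mul_pos hcpos hs.1, by rw [← hcT]; exact mul_lt_mul_of_pos_left hs.2 hcpos⟩
  let v : ℝ → E2 := fun s => u (c * s)
  have hdv : ∀ s, deriv v s = c • deriv u (c * s) := fun s => deriv_comp_mul_left c u s
  have hnv : (fun s => ‖deriv v s‖ ^ 2) = fun s => c ^ 2 * ‖deriv u (c * s)‖ ^ 2 := by
    funext s
    rw [hdv, norm_smul, mul_pow, Real.norm_of_nonneg hcpos.le]
  have hsub : uIcc (0:ℝ) T1 ⊆ uIcc (0:ℝ) T := by
    rw [uIcc_of_le hT1pos.le, uIcc_of_le hT.le]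
    exact Icc_subset_Icc le_rfl hT1T.le
  have hA1 := hA.mono_set hsub
  have hB1 := hB.mono_set hsub
  have hdivT : T1 / c = T := by rw [← hcT]; field_simp
  have hA2 : IntervalIntegrable (fun s => ‖deriv u (c * s)‖ ^ 2) volume 0 T := by
    have := hA1.comp_mul_left (c := c)
    rwa [zero_div, hdivT] at this
  have hB2 : IntervalIntegrable (fun s => h + Vpot α U (v s)) volume 0 T := by
    have := hB1.comp_mul_left (c := c)
    rwa [zero_div, hdivT] at this
  have hadmv : AdmPath α h T U q v := by
    refine ⟨?_, ?_, ?_, ?_, ?_, hB2⟩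
    · refine hcont.comp (by fun_prop) ?_
      intro s hs
      exact ⟨mul_nonneg hcpos.le hs.1, (mul_le_of_le_one_left hs.1 hc1.le).trans hs.2⟩
    · intro s hs
      have h1 := hdiff (c * s) ⟨(hmaps s hs).1, (hmaps s hs).2.trans hT1T⟩
      exact h1.comp s (by fun_prop)
    · simp only [v, mul_zero, hu0]
    · simp only [v, hcT, hT1z']
    · rw [hnv]; exact hA2.const_mul _
  have hIA : ∫ s in (0:ℝ)..T, ‖deriv v s‖ ^ 2 = c * ∫ s in (0:ℝ)..T1, ‖deriv u s‖ ^ 2 := by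
    rw [hnv, intervalIntegral.integral_const_mul,
      intervalIntegral.integral_comp_mul_left (fun s => ‖deriv u s‖ ^ 2) hcpos.ne', mul_zero, hcT,
      smul_eq_mul]
    field_simp
  have hIB : ∫ s in (0:ℝ)..T, (h + Vpot α U (v s)) =
      c⁻¹ * ∫ s in (0:ℝ)..T1, (h + Vpot α U (u s)) := by
    have := intervalIntegral.integral_comp_mul_left (a := 0) (b := T)
      (fun s => h + Vpot α U (u s)) hcpos.ne'
    rw [mul_zero, hcT, smul_eq_mul] at this
    exact this
  have hVnn : ∀ s, 0 ≤ h + Vpot α U (u s) := fun s => add_nonneg hh (Vpot_nonneg hα.1 hUpos _)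
  have hmA : ∫ s in (0:ℝ)..T1, ‖deriv u s‖ ^ 2 ≤ ∫ s in (0:ℝ)..T, ‖deriv u s‖ ^ 2 :=
    intervalIntegral.integral_mono_interval le_rfl hT1pos.le hT1T.le
      (Eventually.of_forall fun s => by positivity) hA
  have hmB : ∫ s in (0:ℝ)..T1, (h + Vpot α U (u s)) ≤ ∫ s in (0:ℝ)..T, (h + Vpot α U (u s)) :=
    intervalIntegral.integral_mono_interval le_rfl hT1pos.le hT1T.le
      (Eventually.of_forall hVnn) hB
  have hB1nn : 0 ≤ ∫ s in (0:ℝ)..T1, (h + Vpot α U (u s)) :=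
    intervalIntegral.integral_nonneg hT1pos.le (fun s _ => hVnn s)
  have hAnn : 0 ≤ ∫ s in (0:ℝ)..T, ‖deriv u s‖ ^ 2 :=
    intervalIntegral.integral_nonneg hT.le (fun s _ => by positivity)
  have hle : MaupertuisT α h T U v ≤ MaupertuisT α h T U u := by
    unfold MaupertuisT
    rw [hIA, hIB]
    have h1 := mul_le_mul hmA hmB hB1nn hAnn
    have h2 : ∀ x y : ℝ, (1/2) * (c * x) * (c⁻¹ * y) = (1/2) * (x * y) := by
      intro x y; field_simp
    rw [h2]
    linarith
  have hposv : 0 < MaupertuisT α h T U v := hpos.trans_le (hmin v hadmv)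
  have hminv : ∀ w, AdmPath α h T U q w → MaupertuisT α h T U v ≤ MaupertuisT α h T U w :=
    fun w hw => hle.trans (hmin w hw)
  have hnev : ∀ s ∈ Ioo (0:ℝ) T, v s ≠ 0 := fun s hs =>
    hune _ (hmaps s hs).1.le (hmaps s hs).2
  obtain ⟨hAp, hBp⟩ := AB_pos hT hposv
  have hel := el_solution hT hUC2 hadmv hnev hminv hBp rfl rfl
  have hen := energy_solution hT hUC2 hadmv hnev hminv hAp hBp rfl rfl
  generalize (1/2) * (∫ s in (0:ℝ)..T, ‖deriv v s‖ ^ 2) = A at *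
  generalize (∫ s in (0:ℝ)..T, (h + Vpot α U (v s))) = B at *
  have hdT1 : DifferentiableAt ℝ u T1 := hdiff T1 ⟨hT1pos, hT1T⟩
  have hdvT : DifferentiableAt ℝ v T := by
    have h1 : DifferentiableAt ℝ u (c * T) := by rw [hcT]; exact hdT1
    exact h1.comp T (by fun_prop)
  obtain ⟨C, hC⟩ := hdvT.hasFDerivAt.isBigO_sub.bound
  have hvT : v T = 0 := hadmv.2.2.2.1
  refine no_diff_collision (κ := A / B) (C := C) hα hT hUC2 hUpos hh hadmv.1 hvT hnev
    (div_pos hAp hBp) hadmv.2.1 hel ?_ ?_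
  · intro s hs
    have h1 := hen s hs
    have h3 : h + Vpot α U (v s) = (1/2) * (B / A * ‖deriv v s‖ ^ 2) := by
      linarith
    rw [h3]
    field_simp
  · filter_upwards [nhdsWithin_le_nhds hC, self_mem_nhdsWithin] with s hs hsT
    have hsT' : s < T := hsT
    rw [hvT, sub_zero, Real.norm_eq_abs, abs_sub_comm, abs_of_pos (sub_pos.2 hsT')] at hs
    exact hs


end MaupAux

/-- Maupertuis principle for collision arcs: a minimizer `u` of `M_h` with
`M_h(u) > 0` solves `ω² ü = ∇V(u)` on `(0,T)`, and `x(t) = u(ωt)` solves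
`ẍ = ∇V(x)` with energy `h` on `[0, T/ω)`, with `x(0) = q` and `x(t) → 0`
as `t → T/ω`. -/
theorem maupertuis_principle
    (α h T ω : ℝ) (hα : α ∈ Set.Ioo (0:ℝ) 2) (hT : 0 < T)
    (U : EuclideanSpace ℝ (Fin 2) → ℝ) (hUC2 : ContDiff ℝ 2 U)
    (hUpos : ∀ s : EuclideanSpace ℝ (Fin 2), ‖s‖ = 1 → 0 < U s)
    (q : EuclideanSpace ℝ (Fin 2)) (hq : q ≠ 0)
    (u u' : ℝ → EuclideanSpace ℝ (Fin 2))
    (hadm : AdmPath α h T U q u)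
    (hderiv : ∀ s ∈ Ioo (0:ℝ) T, HasDerivAt u (u' s) s)
    (hmin : ∀ v, AdmPath α h T U q v →
      MaupertuisT α h T U u ≤ MaupertuisT α h T U v)
    (hpos : 0 < MaupertuisT α h T U u)
    (hω : ω = Real.sqrt ((∫ s in (0:ℝ)..T, (h + Vpot α U (u s))) /
      ((1/2) * ∫ s in (0:ℝ)..T, ‖deriv u s‖ ^ 2))) :
    (∃ u'' : ℝ → EuclideanSpace ℝ (Fin 2),
      ∀ t ∈ Ioo (0:ℝ) T, HasDerivAt u' (u'' t) t ∧
        (ω ^ 2) • u'' t = gradient (Vpot α U) (u t)) ∧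
    (∀ t ∈ Ioo (0:ℝ) (T / ω),
      HasDerivAt (fun τ => u (ω * τ)) (ω • u' (ω * t)) t ∧
      HasDerivAt (fun τ => ω • u' (ω * τ)) (gradient (Vpot α U) (u (ω * t))) t ∧
      (1/2) * ‖ω • u' (ω * t)‖ ^ 2 - Vpot α U (u (ω * t)) = h) ∧
    u (ω * 0) = q ∧
    Tendsto (fun t => u (ω * t)) (nhdsWithin (T / ω) (Iio (T / ω))) (nhds 0) := by
  have hh : 0 ≤ h := by
    by_contra hneg
    obtain ⟨v, hv, hv0⟩ := neg_energy hα.1 hT hUpos hadm (not_le.1 hneg)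
    exact absurd (hpos.trans_le (hmin v hv)) (not_lt.2 hv0)
  have hne := no_interior_zero hα hT hUC2 hUpos hh hq hadm hmin hpos
  obtain ⟨hAp, hBp⟩ := AB_pos hT hpos
  have hel := el_solution hT hUC2 hadm hne hmin hBp rfl rfl
  have hen := energy_solution hT hUC2 hadm hne hmin hAp hBp rfl rfl
  obtain ⟨hcont, -, hu0, huT, -, -⟩ := hadm
  clear hmin hpos
  generalize (1/2) * (∫ s in (0:ℝ)..T, ‖deriv u s‖ ^ 2) = A at *
  generalize (∫ s in (0:ℝ)..T, (h + Vpot α U (u s))) = B at *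
  have hωpos : 0 < ω := by rw [hω]; exact Real.sqrt_pos.2 (div_pos hBp hAp)
  have hω2 : ω ^ 2 = B / A := by rw [hω]; exact Real.sq_sqrt (div_pos hBp hAp).le
  have hω3 : ω * (ω * (A / B)) = 1 := by
    rw [← mul_assoc, ← sq, hω2]; field_simp
  have hu' : ∀ t ∈ Ioo (0:ℝ) T, HasDerivAt u' ((A / B) • gradient (Vpot α U) (u t)) t := by
    intro t ht
    refine (hel t ht).congr_of_eventuallyEq ?_
    filter_upwards [Ioo_mem_nhds ht.1 ht.2] with s hs
    exact (hderiv s hs).deriv.symm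
  have hmaps : ∀ t ∈ Ioo (0:ℝ) (T / ω), ω * t ∈ Ioo (0:ℝ) T := by
    intro t ht
    refine ⟨mul_pos hωpos ht.1, ?_⟩
    have := (lt_div_iff₀ hωpos).1 ht.2
    linarith
  have hlin : ∀ t : ℝ, HasDerivAt (fun τ : ℝ => ω * τ) ω t := fun t => by
    simpa using (hasDerivAt_id t).const_mul ω
  refine ⟨⟨fun t => (A / B) • gradient (Vpot α U) (u t), fun t ht => ⟨hu' t ht, ?_⟩⟩,
    fun t ht => ⟨?_, ?_, ?_⟩, ?_, ?_⟩
  · rw [smul_smul, sq, mul_assoc, hω3, one_smul]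
  · exact (hderiv _ (hmaps t ht)).scomp t (hlin t)
  · have h1 : HasDerivAt (fun τ => ω • u' (ω * τ))
        (ω • ω • (A / B) • gradient (Vpot α U) (u (ω * t))) t :=
      ((hu' _ (hmaps t ht)).scomp t (hlin t)).const_smul ω
    rwa [smul_smul, smul_smul, mul_assoc, hω3, one_smul] at h1
  · have h1 := hen _ (hmaps t ht)
    rw [(hderiv _ (hmaps t ht)).deriv, ← hω2] at h1
    rw [norm_smul, mul_pow, Real.norm_of_nonneg hωpos.le]
    exact h1
  · rw [mul_zero, hu0]
  · have h1 := hcont T ⟨hT.le, le_rfl⟩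
    unfold ContinuousWithinAt at h1
    rw [huT] at h1
    refine h1.comp (tendsto_nhdsWithin_iff.2 ⟨?_, ?_⟩)
    · have h2 : Tendsto (fun t : ℝ => ω * t) (nhds (T / ω)) (nhds (ω * (T / ω))) :=
        (hlin (T / ω)).continuousAt
      rw [mul_div_cancel₀ _ hωpos.ne'] at h2
      exact h2.mono_left nhdsWithin_le_nhds
    · filter_upwards [Ioo_mem_nhdsLT (div_pos hT hωpos)] with t ht
      exact Ioo_subset_Icc_self (hmaps t ht)
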